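/- arXiv:1902.06260 — 7 statements merged into one kernel-verified Lean document; each statement's English description precedes it below -/
import Mathlib

section
/- Let (A, μ, [·,·]) be a Poisson superalgebra over a field K and let φ, ψ : A → A be two commuting even Poisson superalgebra automorphisms (φ∘ψ = ψ∘φ, each preserving both the associative product and the bracket). Define new products on A by [x,y]' := [φ(x), ψ(y)] and μ'(x⊗y) := φ(x)ψ(y) for all x,y ∈ A. Then (A, μ', [·,·]', φ, ψ) is a regular BiHom-Poisson superalgebra. -/
/-- A Poisson superalgebra over a field `K`: a ℤ₂-graded vector space with an even
supercommutative associative product `mu` and an even Lie superbracket `br`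
satisfying the Leibniz superidentity. -/
structure PoissonSuper (K A : Type*) [Field K] [AddCommGroup A] [Module K A] where
  /-- the ℤ₂-grading -/
  grade : ZMod 2 → Submodule K A
  gradeInternal : DirectSum.IsInternal grade
  /-- the Lie superbracket -/
  br : A →ₗ[K] A →ₗ[K] A
  /-- the associative product -/
  mu : A →ₗ[K] A →ₗ[K] A
  br_grade : ∀ (i j : ZMod 2), ∀ x ∈ grade i, ∀ y ∈ grade j, br x y ∈ grade (i + j)
  mu_grade : ∀ (i j : ZMod 2), ∀ x ∈ grade i, ∀ y ∈ grade j, mu x y ∈ grade (i + j)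
  mu_comm : ∀ (i j : ZMod 2), ∀ x ∈ grade i, ∀ y ∈ grade j,
    mu x y = ((-1 : K) ^ (i.val * j.val)) • mu y x
  mu_assoc : ∀ x y z, mu x (mu y z) = mu (mu x y) z
  br_skew : ∀ (i j : ZMod 2), ∀ x ∈ grade i, ∀ y ∈ grade j,
    br x y = -((-1 : K) ^ (i.val * j.val)) • br y x
  br_jacobi : ∀ (i j k : ZMod 2), ∀ x ∈ grade i, ∀ y ∈ grade j, ∀ z ∈ grade k,
    ((-1 : K) ^ (i.val * k.val)) • br x (br y z)
      + ((-1 : K) ^ (i.val * j.val)) • br y (br z x)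
      + ((-1 : K) ^ (j.val * k.val)) • br z (br x y) = 0
  leibniz : ∀ (j k : ZMod 2), ∀ (x : A), ∀ y ∈ grade j, ∀ z ∈ grade k,
    br (mu x y) z = mu x (br y z) + ((-1 : K) ^ (j.val * k.val)) • mu (br x z) y

/-- The axioms of a regular BiHom-Poisson superalgebra for data
`(grade, br, mu, φ, ψ)`: `(A, br, φ, ψ)` is a BiHom-Lie superalgebra,
`(A, mu, φ, ψ)` is BiHom-associative, the BiHom-Leibniz superidentity holds, and
`φ, ψ` are commuting bijective even automorphisms of both products. -/
structure IsRegularBiHomPoissonSuper {K A : Type*} [Field K] [AddCommGroup A] [Module K A]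
    (grade : ZMod 2 → Submodule K A) (br mu : A →ₗ[K] A →ₗ[K] A)
    (phi psi : A →ₗ[K] A) : Prop where
  br_grade : ∀ (i j : ZMod 2), ∀ x ∈ grade i, ∀ y ∈ grade j, br x y ∈ grade (i + j)
  mu_grade : ∀ (i j : ZMod 2), ∀ x ∈ grade i, ∀ y ∈ grade j, mu x y ∈ grade (i + j)
  phi_grade : ∀ (i : ZMod 2), ∀ x ∈ grade i, phi x ∈ grade i
  psi_grade : ∀ (i : ZMod 2), ∀ x ∈ grade i, psi x ∈ grade i
  phi_psi_comm : ∀ x, phi (psi x) = psi (phi x)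
  phi_br : ∀ x y, phi (br x y) = br (phi x) (phi y)
  psi_br : ∀ x y, psi (br x y) = br (psi x) (psi y)
  phi_mu : ∀ x y, phi (mu x y) = mu (phi x) (phi y)
  psi_mu : ∀ x y, psi (mu x y) = mu (psi x) (psi y)
  skew : ∀ (i j : ZMod 2), ∀ x ∈ grade i, ∀ y ∈ grade j,
    br (psi x) (phi y) = -((-1 : K) ^ (i.val * j.val)) • br (psi y) (phi x)
  jacobi : ∀ (i j k : ZMod 2), ∀ x ∈ grade i, ∀ y ∈ grade j, ∀ z ∈ grade k,
    ((-1 : K) ^ (i.val * k.val)) • br (psi (psi x)) (br (psi y) (phi z))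
      + ((-1 : K) ^ (i.val * j.val)) • br (psi (psi y)) (br (psi z) (phi x))
      + ((-1 : K) ^ (j.val * k.val)) • br (psi (psi z)) (br (psi x) (phi y)) = 0
  assoc : ∀ x y z, mu (phi x) (mu y z) = mu (mu x y) (psi z)
  leibniz : ∀ (j k : ZMod 2), ∀ (x : A), ∀ y ∈ grade j, ∀ z ∈ grade k,
    br (mu x y) (phi (psi z))
      = mu (phi x) (br y (phi z)) + ((-1 : K) ^ (j.val * k.val)) • mu (br x (psi z)) (phi y)
  phi_bijective : Function.Bijective phi
  psi_bijective : Function.Bijective psi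

/-- twisting a Poisson superalgebra by two commuting even Poisson
automorphisms `φ, ψ` via `[x,y]' := [φ(x), ψ(y)]` and `x·'y := φ(x)ψ(y)` yields a
regular BiHom-Poisson superalgebra `(A, μ', [·,·]', φ, ψ)`. -/
theorem yau_twist_regular_biHomPoissonSuper
    {K A : Type*} [Field K] [AddCommGroup A] [Module K A]
    (P : PoissonSuper K A) (phi psi : A ≃ₗ[K] A)
    (hcomm : ∀ x, phi (psi x) = psi (phi x))
    (hphig : ∀ (i : ZMod 2), ∀ x ∈ P.grade i, phi x ∈ P.grade i)
    (hpsig : ∀ (i : ZMod 2), ∀ x ∈ P.grade i, psi x ∈ P.grade i)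
    (hphibr : ∀ x y, phi (P.br x y) = P.br (phi x) (phi y))
    (hpsibr : ∀ x y, psi (P.br x y) = P.br (psi x) (psi y))
    (hphimu : ∀ x y, phi (P.mu x y) = P.mu (phi x) (phi y))
    (hpsimu : ∀ x y, psi (P.mu x y) = P.mu (psi x) (psi y)) :
    IsRegularBiHomPoissonSuper P.grade
      (P.br.compl₁₂ (phi : A →ₗ[K] A) (psi : A →ₗ[K] A))
      (P.mu.compl₁₂ (phi : A →ₗ[K] A) (psi : A →ₗ[K] A))
      (phi : A →ₗ[K] A) (psi : A →ₗ[K] A) := by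
  have hphipsig (i : ZMod 2) (x : A) (hx : x ∈ P.grade i) : psi (phi x) ∈ P.grade i :=
    hpsig i _ (hphig i x hx)
  refine
    { br_grade := fun i j x hx y hy => P.br_grade i j _ (hphig i x hx) _ (hpsig j y hy)
      mu_grade := fun i j x hx y hy => P.mu_grade i j _ (hphig i x hx) _ (hpsig j y hy)
      phi_grade := hphig
      psi_grade := hpsig
      phi_psi_comm := hcomm
      phi_br := fun x y => by simp [hphibr, hcomm]
      psi_br := fun x y => by simp [hpsibr, hcomm]
      phi_mu := fun x y => by simp [hphimu, hcomm]
      psi_mu := fun x y => by simp [hpsimu, hcomm]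
      skew := fun i j x hx y hy => ?_
      jacobi := fun i j k x hx y hy z hz => ?_
      assoc := fun x y z => by simp [hphimu, hpsimu, hcomm, P.mu_assoc]
      leibniz := fun j k x y hy z hz => ?_
      phi_bijective := phi.bijective
      psi_bijective := psi.bijective }
  · simpa [hcomm] using P.br_skew i j _ (hphipsig i x hx) _ (hphipsig j y hy)
  · simpa [hpsibr, hcomm] using P.br_jacobi i j k _ (hpsig i _ (hphipsig i x hx))
      _ (hpsig j _ (hphipsig j y hy)) _ (hpsig k _ (hphipsig k z hz))
  · simpa [hphimu, hphibr, hpsibr, hcomm] using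
      P.leibniz j k (phi (phi x)) _ (hphipsig j y hy) _ (hpsig k _ (hphipsig k z hz))
end

section
/- Let (A, [·,·], φ, ψ) be a split regular BiHom-Lie superalgebra with maximal abelian graded subalgebra H and root system Λ. Then for any linear functional α ∈ Λ ∪ {0} on H_0̄ one has φ(A_α) = A_{α∘φ⁻¹}, ψ(A_α) = A_{α∘ψ⁻¹}, φ⁻¹(A_α) = A_{α∘φ}, and ψ⁻¹(A_α) = A_{α∘ψ}. -/
/-- A (regular, with distinguished maximal abelian graded subalgebra `H`)
BiHom-Lie superalgebra over a field `K`. -/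
structure BHLS (K A : Type*) [Field K] [AddCommGroup A] [Module K A] where
  /-- the ℤ₂-grading -/
  grade : ZMod 2 → Submodule K A
  gradeInternal : DirectSum.IsInternal grade
  /-- the bracket -/
  br : A →ₗ[K] A →ₗ[K] A
  /-- the first structure map -/
  phi : A ≃ₗ[K] A
  /-- the second structure map -/
  psi : A ≃ₗ[K] A
  br_grade : ∀ (i j : ZMod 2), ∀ x ∈ grade i, ∀ y ∈ grade j, br x y ∈ grade (i + j)
  phi_grade : ∀ i, (grade i).map (phi : A →ₗ[K] A) = grade i
  psi_grade : ∀ i, (grade i).map (psi : A →ₗ[K] A) = grade i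
  phi_psi_comm : ∀ x, phi (psi x) = psi (phi x)
  phi_br : ∀ x y, phi (br x y) = br (phi x) (phi y)
  psi_br : ∀ x y, psi (br x y) = br (psi x) (psi y)
  skew : ∀ (i j : ZMod 2), ∀ x ∈ grade i, ∀ y ∈ grade j,
    br (psi x) (phi y) = -((-1 : K) ^ (i.val * j.val)) • br (psi y) (phi x)
  jacobi : ∀ (i j k : ZMod 2), ∀ x ∈ grade i, ∀ y ∈ grade j, ∀ z ∈ grade k,
    ((-1 : K) ^ (i.val * k.val)) • br (psi (psi x)) (br (psi y) (phi z))
      + ((-1 : K) ^ (i.val * j.val)) • br (psi (psi y)) (br (psi z) (phi x))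
      + ((-1 : K) ^ (j.val * k.val)) • br (psi (psi z)) (br (psi x) (phi y)) = 0
  /-- the maximal abelian graded subalgebra -/
  H : Submodule K A
  H_graded : H = (H ⊓ grade 0) ⊔ (H ⊓ grade 1)
  H_abelian : ∀ x ∈ H, ∀ y ∈ H, br x y = 0
  phi_H : H.map (phi : A →ₗ[K] A) = H
  psi_H : H.map (psi : A →ₗ[K] A) = H
  H_max : ∀ H' : Submodule K A, H ≤ H' →
    H' = (H' ⊓ grade 0) ⊔ (H' ⊓ grade 1) →
    (∀ x ∈ H', ∀ y ∈ H', br x y = 0) →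
    H'.map (phi : A →ₗ[K] A) = H' → H'.map (psi : A →ₗ[K] A) = H' → H' = H

namespace BHLS

variable {K A : Type*} [Field K] [AddCommGroup A] [Module K A] (D : BHLS K A)

/-- The even part `H₀` of `H`. -/
def H0 : Submodule K A := D.H ⊓ D.grade 0

lemma phi_H0 : D.H0.map (D.phi : A →ₗ[K] A) = D.H0 := by
  unfold H0
  rw [Submodule.map_inf (D.phi : A →ₗ[K] A) D.phi.injective, D.phi_H, D.phi_grade]

lemma psi_H0 : D.H0.map (D.psi : A →ₗ[K] A) = D.H0 := by
  unfold H0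
  rw [Submodule.map_inf (D.psi : A →ₗ[K] A) D.psi.injective, D.psi_H, D.psi_grade]

/-- The restriction of `φ` to `H₀`, as a linear automorphism. -/
def phiH0 : ↥D.H0 ≃ₗ[K] ↥D.H0 :=
  (D.phi.submoduleMap D.H0).trans (LinearEquiv.ofEq _ _ D.phi_H0)

/-- The restriction of `ψ` to `H₀`, as a linear automorphism. -/
def psiH0 : ↥D.H0 ≃ₗ[K] ↥D.H0 :=
  (D.psi.submoduleMap D.H0).trans (LinearEquiv.ofEq _ _ D.psi_H0)

/-- The root space attached to a linear functional `α : H₀ → K`: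
`A_α = {v : [h, φ(v)] = α(h) • φψ(v) for all h ∈ H₀}`. -/
def rootSpace (α : Module.Dual K ↥D.H0) : Submodule K A where
  carrier := {v | ∀ h : ↥D.H0, D.br (h : A) (D.phi v) = α h • D.phi (D.psi v)}
  add_mem' := by
    intro a b ha hb h
    simp only [map_add, ha h, hb h, smul_add]
  zero_mem' := by
    intro h
    simp
  smul_mem' := by
    intro c v hv h
    simp only [map_smul, hv h]
    rw [smul_comm]

/-- The root system `Λ`. -/
def roots : Set (Module.Dual K ↥D.H0) := {α | α ≠ 0 ∧ D.rootSpace α ≠ ⊥}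

/-- `A` is split with respect to `H`: `A = H ⊕ (⊕_{α ∈ Λ} A_α)`. -/
def IsSplit : Prop :=
  letI := Classical.decEq (Option ↥D.roots)
  DirectSum.IsInternal (fun o : Option ↥D.roots => o.elim D.H fun α => D.rootSpace α.1)

/-- `α ∘ φ^{z₁} ∘ ψ^{z₂}`. -/
def twist (z₁ z₂ : ℤ) (γ : Module.Dual K ↥D.H0) : Module.Dual K ↥D.H0 :=
  γ ∘ₗ ((((D.phiH0 ^ z₁) : ↥D.H0 ≃ₗ[K] ↥D.H0) : ↥D.H0 →ₗ[K] ↥D.H0) ∘ₗ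
        (((D.psiH0 ^ z₂) : ↥D.H0 ≃ₗ[K] ↥D.H0) : ↥D.H0 →ₗ[K] ↥D.H0))

@[simp]
lemma coe_phiH0 (h : ↥D.H0) : (D.phiH0 h : A) = D.phi h := rfl

@[simp]
lemma coe_psiH0 (h : ↥D.H0) : (D.psiH0 h : A) = D.psi h := rfl

/-- An automorphism of the bracket commuting with `φ` and `ψ` and restricting to `τ` on `H₀`
maps `A_{β ∘ τ}` onto `A_β`. -/
lemma map_rootSpace_eq (σ : A ≃ₗ[K] A) (τ : ↥D.H0 ≃ₗ[K] ↥D.H0)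
    (hbr : ∀ x y, σ (D.br x y) = D.br (σ x) (σ y))
    (hphi : ∀ x, σ (D.phi x) = D.phi (σ x)) (hpsi : ∀ x, σ (D.psi x) = D.psi (σ x))
    (hτ : ∀ h : ↥D.H0, (τ h : A) = σ h) {α β : Module.Dual K ↥D.H0}
    (hβ : ∀ h, β (τ h) = α h) :
    (D.rootSpace α).map (σ : A →ₗ[K] A) = D.rootSpace β := by
  have key : ∀ v, σ v ∈ D.rootSpace β ↔ v ∈ D.rootSpace α := by
    intro v
    change (∀ h : ↥D.H0, D.br (h : A) (D.phi (σ v)) = β h • D.phi (D.psi (σ v))) ↔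
      ∀ h : ↥D.H0, D.br (h : A) (D.phi v) = α h • D.phi (D.psi v)
    rw [τ.surjective.forall]
    refine forall_congr' fun h => ?_
    rw [hτ, hβ, ← hpsi, ← hphi, ← hphi, ← hbr, ← map_smul, σ.injective.eq_iff]
  ext w
  obtain ⟨v, rfl⟩ := σ.surjective w
  rw [key, Submodule.mem_map_equiv, σ.symm_apply_apply]

/-- for `α ∈ Λ ∪ {0}`, `φ(A_α) = A_{α∘φ⁻¹}`, `ψ(A_α) = A_{α∘ψ⁻¹}`,
`φ⁻¹(A_α) = A_{α∘φ}` and `ψ⁻¹(A_α) = A_{α∘ψ}`. -/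
theorem rootSpace_map {K A : Type*} [Field K] [AddCommGroup A] [Module K A] (D : BHLS K A)
    (hsplit : D.IsSplit)
    (α : Module.Dual K ↥D.H0) (hα : α ∈ D.roots ∨ α = 0) :
    (D.rootSpace α).map (D.phi : A →ₗ[K] A) = D.rootSpace (D.twist (-1) 0 α) ∧
    (D.rootSpace α).map (D.psi : A →ₗ[K] A) = D.rootSpace (D.twist 0 (-1) α) ∧
    (D.rootSpace α).map (D.phi.symm : A →ₗ[K] A) = D.rootSpace (D.twist 1 0 α) ∧
    (D.rootSpace α).map (D.psi.symm : A →ₗ[K] A) = D.rootSpace (D.twist 0 1 α) := by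
  have psi_phi (x : A) : D.psi (D.phi x) = D.phi (D.psi x) := (D.phi_psi_comm x).symm
  refine ⟨D.map_rootSpace_eq D.phi D.phiH0 D.phi_br (fun _ => rfl) D.phi_psi_comm
      D.coe_phiH0 fun h => ?_,
    D.map_rootSpace_eq D.psi D.psiH0 D.psi_br psi_phi (fun _ => rfl) D.coe_psiH0 fun h => ?_,
    D.map_rootSpace_eq D.phi.symm D.phiH0.symm (fun x y => ?_) (fun x => ?_) (fun x => ?_)
      (fun h => ?_) fun h => ?_,
    D.map_rootSpace_eq D.psi.symm D.psiH0.symm (fun x y => ?_) (fun x => ?_) (fun x => ?_)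
      (fun h => ?_) fun h => ?_⟩
  · exact congrArg α (D.phiH0.symm_apply_apply h)
  · exact congrArg α (D.psiH0.symm_apply_apply h)
  · simp [LinearEquiv.symm_apply_eq, D.phi_br]
  · simp
  · simp [LinearEquiv.symm_apply_eq, D.phi_psi_comm]
  · rw [LinearEquiv.eq_symm_apply, ← coe_phiH0, LinearEquiv.apply_symm_apply]
  · exact congrArg α (D.phiH0.apply_symm_apply h)
  · simp [LinearEquiv.symm_apply_eq, D.psi_br]
  · simp [LinearEquiv.symm_apply_eq, psi_phi]
  · simp
  · rw [LinearEquiv.eq_symm_apply, ← coe_psiH0, LinearEquiv.apply_symm_apply]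
  · exact congrArg α (D.psiH0.apply_symm_apply h)

end BHLS
end

section
/- Let (A, [·,·], φ, ψ) be a split regular BiHom-Lie superalgebra with maximal abelian graded subalgebra H and root system Λ. Then for any α, β ∈ Λ ∪ {0} one has [A_α, A_β] ⊆ A_{α∘φ⁻¹ + β∘ψ⁻¹}. -/
namespace BHLS

variable {K A : Type*} [Field K] [AddCommGroup A] [Module K A] (D : BHLS K A)

lemma isCompl_grade : IsCompl (D.grade 0) (D.grade 1) :=
  (DirectSum.isInternal_submodule_iff_isCompl D.grade (by decide : (0 : ZMod 2) ≠ 1)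
    (by ext i; revert i; simp; decide)).mp D.gradeInternal

lemma phi_mem_grade {i : ZMod 2} {x : A} (hx : x ∈ D.grade i) : D.phi x ∈ D.grade i := by
  rw [← D.phi_grade i]
  exact Submodule.mem_map_of_mem hx

lemma psi_mem_grade {i : ZMod 2} {x : A} (hx : x ∈ D.grade i) : D.psi x ∈ D.grade i := by
  rw [← D.psi_grade i]
  exact Submodule.mem_map_of_mem hx

lemma psi_symm_mem_grade {i : ZMod 2} {x : A} (hx : x ∈ D.grade i) :
    D.psi.symm x ∈ D.grade i := by
  rw [← D.psi_grade i] at hx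
  obtain ⟨y, hy, rfl⟩ := hx
  simpa using hy

lemma twist_neg_one_zero_apply (γ : Module.Dual K ↥D.H0) (h : ↥D.H0) :
    D.twist (-1) 0 γ h = γ (D.phiH0.symm h) := by
  simp only [twist, zpow_neg_one, zpow_zero]
  rfl

lemma twist_zero_neg_one_apply (γ : Module.Dual K ↥D.H0) (h : ↥D.H0) :
    D.twist 0 (-1) γ h = γ (D.psiH0.symm h) := by
  simp only [twist, zpow_neg_one, zpow_zero]
  rfl

variable {D}

lemma mem_rootSpace {α : Module.Dual K ↥D.H0} {v : A} :
    v ∈ D.rootSpace α ↔ ∀ h : ↥D.H0, D.br (h : A) (D.phi v) = α h • D.phi (D.psi v) :=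
  Iff.rfl

variable (D)

/-- Root spaces are graded. -/
lemma exists_homogeneous_add_of_mem_rootSpace {α : Module.Dual K ↥D.H0} {v : A}
    (hv : v ∈ D.rootSpace α) :
    ∃ a ∈ D.rootSpace α ⊓ D.grade 0, ∃ b ∈ D.rootSpace α ⊓ D.grade 1, a + b = v := by
  obtain ⟨a, ha, b, hb, rfl⟩ := Submodule.mem_sup.mp
    (D.isCompl_grade.sup_eq_top ▸ Submodule.mem_top : v ∈ D.grade 0 ⊔ D.grade 1)
  have defect_mem {i : ZMod 2} {x : A} (hx : x ∈ D.grade i) (h : ↥D.H0) :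
      D.br (h : A) (D.phi x) - α h • D.phi (D.psi x) ∈ D.grade i :=
    sub_mem (by simpa using D.br_grade 0 i h h.2.2 _ (D.phi_mem_grade hx))
      (Submodule.smul_mem _ _ (D.phi_mem_grade (D.psi_mem_grade hx)))
  have defect_add (h : ↥D.H0) : (D.br (h : A) (D.phi a) - α h • D.phi (D.psi a)) +
      (D.br (h : A) (D.phi b) - α h • D.phi (D.psi b)) = 0 := by
    have := mem_rootSpace.mp hv h
    simp only [map_add, smul_add] at this
    rw [sub_add_sub_comm, this, sub_self]
  have defect_left (h : ↥D.H0) : D.br (h : A) (D.phi a) - α h • D.phi (D.psi a) = 0 := by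
    refine Submodule.disjoint_def.mp D.isCompl_grade.disjoint _ (defect_mem ha h) ?_
    rw [eq_neg_of_add_eq_zero_left (defect_add h)]
    exact neg_mem (defect_mem hb h)
  refine ⟨a, ⟨fun h => sub_eq_zero.mp (defect_left h), ha⟩, b, ⟨fun h => ?_, hb⟩, rfl⟩
  have := defect_add h
  rw [defect_left, zero_add] at this
  exact sub_eq_zero.mp this

lemma br_psi_symm_phi {α : Module.Dual K ↥D.H0} {x : A} (hx : x ∈ D.rootSpace α) (h : ↥D.H0) :
    D.br (D.psiH0.symm h : A) (D.phi (D.psi.symm (D.phi x))) =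
      α (D.phiH0.symm h) • D.phi (D.phi x) := by
  apply D.psi.injective
  have hφ : D.phi (D.phiH0.symm h : A) = h := by rw [← coe_phiH0, LinearEquiv.apply_symm_apply]
  have hψ : D.psi (D.psiH0.symm h : A) = h := by rw [← coe_psiH0, LinearEquiv.apply_symm_apply]
  have := congrArg D.phi (mem_rootSpace.mp hx (D.phiH0.symm h))
  rw [D.phi_br, hφ] at this
  rw [D.psi_br, hψ, ← D.phi_psi_comm, LinearEquiv.apply_symm_apply, this]
  simp only [map_smul, D.phi_psi_comm]

lemma br_mem_rootSpace_of_homogeneous {α β : Module.Dual K ↥D.H0} {i j : ZMod 2} {x y : A}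
    (hx : x ∈ D.rootSpace α) (hxi : x ∈ D.grade i) (hy : y ∈ D.rootSpace β)
    (hyj : y ∈ D.grade j) :
    D.br x y ∈ D.rootSpace (D.twist (-1) 0 α + D.twist 0 (-1) β) := by
  rw [mem_rootSpace]
  intro h
  set u := D.psiH0.symm h with hu
  set t := D.psiH0.symm u with ht
  have hψu : D.psi (u : A) = h := by rw [← coe_psiH0, hu, LinearEquiv.apply_symm_apply]
  have hψt : D.psi (t : A) = u := by rw [← coe_psiH0, ht, LinearEquiv.apply_symm_apply]
  have jac := D.jacobi 0 i j t t.2.2 (D.psi.symm (D.phi x))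
    (D.psi_symm_mem_grade (D.phi_mem_grade hxi)) y hyj
  have skew_y := D.skew j 0 y hyj t t.2.2
  rw [hψt, mem_rootSpace.mp hy u] at skew_y
  have skew_yx := D.skew j i (D.psi y) (D.psi_mem_grade hyj) (D.phi x) (D.phi_mem_grade hxi)
  have sign_sq : ((-1 : K) ^ (i.val * j.val)) * (-1 : K) ^ (i.val * j.val) = 1 := by
    rw [← mul_pow]; simp
  rw [hψt, hψu, skew_y, br_psi_symm_phi D hx h, map_smul (D.br _) (α _), skew_yx] at jac
  simp only [LinearEquiv.apply_symm_apply, ZMod.val_zero, zero_mul, mul_zero, pow_zero, one_smul,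
    neg_smul, map_neg, map_smul, smul_neg, mul_comm j.val i.val] at jac
  rw [smul_comm _ (α _), smul_smul ((-1 : K) ^ _), sign_sq, one_smul] at jac
  rw [D.phi_br, D.psi_br, D.phi_br, LinearMap.add_apply, twist_neg_one_zero_apply,
    twist_zero_neg_one_apply, ← hu, add_smul, D.phi_psi_comm x]
  rw [← sub_eq_zero, ← jac]
  abel

/-- for `α, β ∈ Λ ∪ {0}`, `[A_α, A_β] ⊆ A_{α∘φ⁻¹ + β∘ψ⁻¹}`. -/
theorem rootSpace_bracket {K A : Type*} [Field K] [AddCommGroup A] [Module K A] (D : BHLS K A)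
    (hsplit : D.IsSplit)
    (α β : Module.Dual K ↥D.H0)
    (hα : α ∈ D.roots ∨ α = 0) (hβ : β ∈ D.roots ∨ β = 0) :
    Submodule.map₂ D.br (D.rootSpace α) (D.rootSpace β)
      ≤ D.rootSpace (D.twist (-1) 0 α + D.twist 0 (-1) β) := by
  rw [Submodule.map₂_le]
  intro x hx y hy
  obtain ⟨x₀, hx₀, x₁, hx₁, rfl⟩ := D.exists_homogeneous_add_of_mem_rootSpace hx
  obtain ⟨y₀, hy₀, y₁, hy₁, rfl⟩ := D.exists_homogeneous_add_of_mem_rootSpace hy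
  simp only [map_add, LinearMap.add_apply]
  exact add_mem
    (add_mem (D.br_mem_rootSpace_of_homogeneous hx₀.1 hx₀.2 hy₀.1 hy₀.2)
      (D.br_mem_rootSpace_of_homogeneous hx₁.1 hx₁.2 hy₀.1 hy₀.2))
    (add_mem (D.br_mem_rootSpace_of_homogeneous hx₀.1 hx₀.2 hy₁.1 hy₁.2)
      (D.br_mem_rootSpace_of_homogeneous hx₁.1 hx₁.2 hy₁.1 hy₁.2))

end BHLS
end

section
/- Let (A, [·,·], φ, ψ) be a split regular BiHom-Lie superalgebra with maximal abelian graded subalgebra H and root system Λ. If α ∈ Λ, then α∘φ^{−z₁}∘ψ^{−z₂} ∈ Λ for any integers z₁, z₂ ∈ ℤ. -/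
namespace BHLS

variable {K A : Type*} [Field K] [AddCommGroup A] [Module K A] (D : BHLS K A)

theorem rootSpace_comp (s : A ≃ₗ[K] A) (t : ↥D.H0 ≃ₗ[K] ↥D.H0)
    (hst : ∀ h, (t h : A) = s h) (hbr : ∀ x y, s (D.br x y) = D.br (s x) (s y))
    (hphi : ∀ x, s (D.phi x) = D.phi (s x)) (hpsi : ∀ x, s (D.psi x) = D.psi (s x))
    (γ : Module.Dual K ↥D.H0) :
    D.rootSpace (γ ∘ₗ (t : ↥D.H0 →ₗ[K] ↥D.H0)) =
      (D.rootSpace γ).comap (s : A →ₗ[K] A) := by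
  ext v
  change (∀ h : ↥D.H0, D.br (h : A) (D.phi v) = γ (t h) • D.phi (D.psi v)) ↔
    ∀ h : ↥D.H0, D.br (h : A) (D.phi (s v)) = γ h • D.phi (D.psi (s v))
  rw [t.surjective.forall (p := fun h => D.br (h : A) (D.phi (s v)) =
    γ h • D.phi (D.psi (s v)))]
  refine forall_congr' fun h => ?_
  rw [hst, ← hphi, ← hpsi, ← hphi, ← hbr, ← s.map_smul, s.injective.eq_iff]

theorem comp_mem_roots_iff (s : A ≃ₗ[K] A) (t : ↥D.H0 ≃ₗ[K] ↥D.H0)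
    (hst : ∀ h, (t h : A) = s h) (hbr : ∀ x y, s (D.br x y) = D.br (s x) (s y))
    (hphi : ∀ x, s (D.phi x) = D.phi (s x)) (hpsi : ∀ x, s (D.psi x) = D.psi (s x))
    (γ : Module.Dual K ↥D.H0) :
    γ ∘ₗ (t : ↥D.H0 →ₗ[K] ↥D.H0) ∈ D.roots ↔ γ ∈ D.roots := by
  have hbot : (D.rootSpace γ).comap (s : A →ₗ[K] A) = ⊥ ↔ D.rootSpace γ = ⊥ := by
    rw [Submodule.comap_equiv_eq_map_symm, Submodule.map_eq_bot_iff]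
  have hzero : γ ∘ₗ (t : ↥D.H0 →ₗ[K] ↥D.H0) = 0 ↔ γ = 0 := by
    rw [← LinearMap.cancel_right (f := γ) (f' := 0) t.surjective, LinearMap.zero_comp]
  change _ ≠ _ ∧ _ ≠ _ ↔ _ ≠ _ ∧ _ ≠ _
  rw [D.rootSpace_comp s t hst hbr hphi hpsi γ, Ne, Ne, hbot, hzero]

/-- The linear automorphisms of `H₀` that preserve the root system. -/
def rootStabilizer : Subgroup (↥D.H0 ≃ₗ[K] ↥D.H0) where
  carrier := {t | ∀ γ : Module.Dual K ↥D.H0,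
    γ ∘ₗ (t : ↥D.H0 →ₗ[K] ↥D.H0) ∈ D.roots ↔ γ ∈ D.roots}
  one_mem' _ := Iff.rfl
  mul_mem' {a b} ha hb γ :=
    (hb (γ ∘ₗ (a : ↥D.H0 →ₗ[K] ↥D.H0))).trans (ha γ)
  inv_mem' {a} ha γ := by
    rw [← ha]
    have h : (γ ∘ₗ ((a⁻¹ : ↥D.H0 ≃ₗ[K] ↥D.H0) : ↥D.H0 →ₗ[K] ↥D.H0)) ∘ₗ
        (a : ↥D.H0 →ₗ[K] ↥D.H0) = γ :=
      LinearMap.ext fun x => congrArg γ (a.symm_apply_apply x)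
    rw [h]

theorem phiH0_mem_rootStabilizer : D.phiH0 ∈ D.rootStabilizer :=
  D.comp_mem_roots_iff D.phi D.phiH0 (fun _ => rfl) D.phi_br (fun _ => rfl) D.phi_psi_comm

theorem psiH0_mem_rootStabilizer : D.psiH0 ∈ D.rootStabilizer :=
  D.comp_mem_roots_iff D.psi D.psiH0 (fun _ => rfl) D.psi_br
    (fun x => (D.phi_psi_comm x).symm) (fun _ => rfl)

/-- if `α ∈ Λ` then `α∘φ^{−z₁}∘ψ^{−z₂} ∈ Λ` for all `z₁, z₂ ∈ ℤ`. -/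
theorem twist_root_mem {K A : Type*} [Field K] [AddCommGroup A] [Module K A] (D : BHLS K A)
    (hsplit : D.IsSplit)
    (α : Module.Dual K ↥D.H0) (hα : α ∈ D.roots) (z₁ z₂ : ℤ) :
    D.twist (-z₁) (-z₂) α ∈ D.roots := by
  exact ((zpow_mem D.psiH0_mem_rootStabilizer (-z₂)) _).2
    (((zpow_mem D.phiH0_mem_rootStabilizer (-z₁)) α).2 hα)

end BHLS
end

section
/- Let (A, [·,·], φ, ψ) be a split regular BiHom-Lie superalgebra with maximal abelian graded subalgebra H and root system Λ. Then the root space associated to the zero functional equals H, i.e. A_0 = H. -/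
namespace BHLS

variable {K A : Type*} [Field K] [AddCommGroup A] [Module K A] (D : BHLS K A)

/-- If `T` acts on each summand `N i` of an internal direct sum as the scalar `c i`, then the `i`-th
component of a vector killed by `T` is killed by `c i`. -/
lemma smul_component_eq_zero_of_apply_eq_zero {ι K A : Type*} [DecidableEq ι] [Field K]
    [AddCommGroup A] [Module K A] {N : ι → Submodule K A} (hN : DirectSum.IsInternal N)
    (T : A →ₗ[K] A) (c : ι → K) (hT : ∀ i, ∀ x ∈ N i, T x = c i • x)
    (f : DirectSum ι fun i => N i) (hf : T (DirectSum.coeLinearMap N f) = 0) (i : ι) :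
    c i • f i = 0 := by
  let S := DirectSum.lmap fun i => c i • (LinearMap.id : N i →ₗ[K] N i)
  have hS : DirectSum.coeLinearMap N ∘ₗ S = T ∘ₗ DirectSum.coeLinearMap N := by
    ext j x
    simp [S, hT j x x.2]
  have hSf : S f = 0 := hN.injective <| by
    have := LinearMap.congr_fun hS f
    simp only [LinearMap.comp_apply, hf] at this
    exact this.trans (map_zero (DirectSum.coeAddMonoidHom N)).symm
  exact (DirectSum.lmap_apply _ f i).symm.trans (DFunLike.congr_fun hSf i)

lemma H_le_rootSpace_zero : D.H ≤ D.rootSpace 0 := by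
  intro v hv h
  have hφ : D.phi v ∈ D.H := by
    rw [← D.phi_H]
    exact Submodule.mem_map_of_mem hv
  simp [D.H_abelian h h.2.1 _ hφ]

/-- The operator `v ↦ (φψ)⁻¹ [h, φ(v)]`, which acts on `A_α` as the scalar `α(h)`. -/
def twistedAd (h : D.H0) : A →ₗ[K] A :=
  (D.psi.trans D.phi).symm.toLinearMap ∘ₗ D.br (h : A) ∘ₗ D.phi.toLinearMap

lemma twistedAd_of_mem_rootSpace (h : D.H0) {α : Module.Dual K D.H0} {v : A}
    (hv : v ∈ D.rootSpace α) : D.twistedAd h v = α h • v := by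
  have hv' : D.br (h : A) (D.phi v) = α h • D.phi (D.psi v) := hv h
  simp [twistedAd, hv']

/-- `A_0 = H`. -/
theorem rootSpace_zero {K A : Type*} [Field K] [AddCommGroup A] [Module K A] (D : BHLS K A)
    (hsplit : D.IsSplit) :
    D.rootSpace 0 = D.H := by
  classical
  refine le_antisymm (fun v hv => ?_) D.H_le_rootSpace_zero
  let N : Option D.roots → Submodule K A := fun o => o.elim D.H fun α => D.rootSpace α.1
  have hN : DirectSum.IsInternal N := by
    unfold IsSplit at hsplit
    convert hsplit
  obtain ⟨f, rfl⟩ : ∃ f, DirectSum.coeLinearMap N f = v := hN.surjective v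
  have hcomp (α : D.roots) : f (some α) = 0 := by
    obtain ⟨h, hh⟩ := DFunLike.ne_iff.mp α.2.1
    refine (smul_eq_zero.mp (smul_component_eq_zero_of_apply_eq_zero hN (D.twistedAd h)
      (fun o => o.elim 0 fun β => β.1 h) ?_ f ?_ (some α))).resolve_left hh
    · rintro (_ | β) x hx
      · simpa using D.twistedAd_of_mem_rootSpace h (D.H_le_rootSpace_zero hx)
      · exact D.twistedAd_of_mem_rootSpace h hx
    · simpa using D.twistedAd_of_mem_rootSpace h hv
  have hf : f = DirectSum.lof K _ (fun o => N o) none (f none) := by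
    ext (_ | α)
    · simp [DirectSum.lof_eq_of]
    · rw [hcomp, DirectSum.lof_eq_of, DirectSum.of_eq_of_ne _ _ _ (by simp)]
  rw [hf, DirectSum.coeLinearMap_lof]
  exact (f none).2

end BHLS
end

section
/- Let A be a split regular BiHom-Poisson superalgebra with maximal abelian graded subalgebra H and root system Λ. Then for any α, β ∈ Λ ∪ {0}, the associative-type product satisfies A_α · A_β ⊆ A_{α∘φ⁻¹ + β∘ψ⁻¹}. -/
/-- A (regular, with distinguished maximal abelian graded subalgebra `H`)
BiHom-Poisson superalgebra over a field `K`. -/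
structure BHPS (K A : Type*) [Field K] [AddCommGroup A] [Module K A] where
  /-- the ℤ₂-grading -/
  grade : ZMod 2 → Submodule K A
  gradeInternal : DirectSum.IsInternal grade
  /-- the bracket -/
  br : A →ₗ[K] A →ₗ[K] A
  /-- the associative-type product -/
  mu : A →ₗ[K] A →ₗ[K] A
  /-- the first structure map -/
  phi : A ≃ₗ[K] A
  /-- the second structure map -/
  psi : A ≃ₗ[K] A
  br_grade : ∀ (i j : ZMod 2), ∀ x ∈ grade i, ∀ y ∈ grade j, br x y ∈ grade (i + j)
  mu_grade : ∀ (i j : ZMod 2), ∀ x ∈ grade i, ∀ y ∈ grade j, mu x y ∈ grade (i + j)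
  phi_grade : ∀ i, (grade i).map (phi : A →ₗ[K] A) = grade i
  psi_grade : ∀ i, (grade i).map (psi : A →ₗ[K] A) = grade i
  phi_psi_comm : ∀ x, phi (psi x) = psi (phi x)
  phi_br : ∀ x y, phi (br x y) = br (phi x) (phi y)
  psi_br : ∀ x y, psi (br x y) = br (psi x) (psi y)
  phi_mu : ∀ x y, phi (mu x y) = mu (phi x) (phi y)
  psi_mu : ∀ x y, psi (mu x y) = mu (psi x) (psi y)
  skew : ∀ (i j : ZMod 2), ∀ x ∈ grade i, ∀ y ∈ grade j,
    br (psi x) (phi y) = -((-1 : K) ^ (i.val * j.val)) • br (psi y) (phi x)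
  jacobi : ∀ (i j k : ZMod 2), ∀ x ∈ grade i, ∀ y ∈ grade j, ∀ z ∈ grade k,
    ((-1 : K) ^ (i.val * k.val)) • br (psi (psi x)) (br (psi y) (phi z))
      + ((-1 : K) ^ (i.val * j.val)) • br (psi (psi y)) (br (psi z) (phi x))
      + ((-1 : K) ^ (j.val * k.val)) • br (psi (psi z)) (br (psi x) (phi y)) = 0
  assoc : ∀ x y z, mu (phi x) (mu y z) = mu (mu x y) (psi z)
  leibniz : ∀ (j k : ZMod 2), ∀ (x : A), ∀ y ∈ grade j, ∀ z ∈ grade k,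
    br (mu x y) (phi (psi z))
      = mu (phi x) (br y (phi z)) + ((-1 : K) ^ (j.val * k.val)) • mu (br x (psi z)) (phi y)
  /-- the maximal abelian graded subalgebra -/
  H : Submodule K A
  H_graded : H = (H ⊓ grade 0) ⊔ (H ⊓ grade 1)
  H_abelian : ∀ x ∈ H, ∀ y ∈ H, br x y = 0
  phi_H : H.map (phi : A →ₗ[K] A) = H
  psi_H : H.map (psi : A →ₗ[K] A) = H
  H_max : ∀ H' : Submodule K A, H ≤ H' →
    H' = (H' ⊓ grade 0) ⊔ (H' ⊓ grade 1) →
    (∀ x ∈ H', ∀ y ∈ H', br x y = 0) →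
    H'.map (phi : A →ₗ[K] A) = H' → H'.map (psi : A →ₗ[K] A) = H' → H' = H

namespace BHPS

variable {K A : Type*} [Field K] [AddCommGroup A] [Module K A] (D : BHPS K A)

/-- The even part `H₀` of `H`. -/
def H0 : Submodule K A := D.H ⊓ D.grade 0

lemma phi_H0 : D.H0.map (D.phi : A →ₗ[K] A) = D.H0 := by
  unfold H0
  rw [Submodule.map_inf (D.phi : A →ₗ[K] A) D.phi.injective, D.phi_H, D.phi_grade]

lemma psi_H0 : D.H0.map (D.psi : A →ₗ[K] A) = D.H0 := by
  unfold H0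
  rw [Submodule.map_inf (D.psi : A →ₗ[K] A) D.psi.injective, D.psi_H, D.psi_grade]

/-- The restriction of `φ` to `H₀`, as a linear automorphism. -/
def phiH0 : ↥D.H0 ≃ₗ[K] ↥D.H0 :=
  (D.phi.submoduleMap D.H0).trans (LinearEquiv.ofEq _ _ D.phi_H0)

/-- The restriction of `ψ` to `H₀`, as a linear automorphism. -/
def psiH0 : ↥D.H0 ≃ₗ[K] ↥D.H0 :=
  (D.psi.submoduleMap D.H0).trans (LinearEquiv.ofEq _ _ D.psi_H0)

/-- The root space attached to a linear functional `α : H₀ → K`: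
`A_α = {v : [h, φ(v)] = α(h) • φψ(v) for all h ∈ H₀}`. -/
def rootSpace (α : Module.Dual K ↥D.H0) : Submodule K A where
  carrier := {v | ∀ h : ↥D.H0, D.br (h : A) (D.phi v) = α h • D.phi (D.psi v)}
  add_mem' := by
    intro a b ha hb h
    simp only [map_add, ha h, hb h, smul_add]
  zero_mem' := by
    intro h
    simp
  smul_mem' := by
    intro c v hv h
    simp only [map_smul, hv h]
    rw [smul_comm]

/-- The root system `Λ`. -/
def roots : Set (Module.Dual K ↥D.H0) := {α | α ≠ 0 ∧ D.rootSpace α ≠ ⊥}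

/-- `A` is split with respect to `H`: `A = H ⊕ (⊕_{α ∈ Λ} A_α)`. -/
def IsSplit : Prop :=
  letI := Classical.decEq (Option ↥D.roots)
  DirectSum.IsInternal (fun o : Option ↥D.roots => o.elim D.H fun α => D.rootSpace α.1)

/-- `α ∘ φ^{z₁} ∘ ψ^{z₂}`. -/
def twist (z₁ z₂ : ℤ) (γ : Module.Dual K ↥D.H0) : Module.Dual K ↥D.H0 :=
  γ ∘ₗ ((((D.phiH0 ^ z₁) : ↥D.H0 ≃ₗ[K] ↥D.H0) : ↥D.H0 →ₗ[K] ↥D.H0) ∘ₗ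
        (((D.psiH0 ^ z₂) : ↥D.H0 ≃ₗ[K] ↥D.H0) : ↥D.H0 →ₗ[K] ↥D.H0))

/-- `±S = S ∪ (-S)`. -/
def pm (S : Set (Module.Dual K ↥D.H0)) : Set (Module.Dual K ↥D.H0) :=
  S ∪ (Neg.neg '' S)

/-- The partial sums `α₁∘φ^{-i} + α₂∘φ^{-i+1}∘ψ^{-1} + ⋯ + α_i∘φ^{-1}∘ψ^{-1} + α_{i+1}∘ψ^{-1}`
appearing in the definition of a connection. -/
def chainSum (a : ℕ → Module.Dual K ↥D.H0) (i : ℕ) : Module.Dual K ↥D.H0 :=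
  D.twist (-(i : ℤ)) 0 (a 1)
    + ∑ t ∈ Finset.Icc 2 (i + 1), D.twist (-((i : ℤ) + 1 - (t : ℤ))) (-1) (a t)

/-- `a 1, …, a k` is a connection from `α` to `β` (relative to the set of roots `S`). -/
def IsConnectionIn (S : Set (Module.Dual K ↥D.H0)) (α β : Module.Dual K ↥D.H0)
    (k : ℕ) (a : ℕ → Module.Dual K ↥D.H0) : Prop :=
  2 ≤ k ∧
  (∀ t, 1 ≤ t → t ≤ k → a t ∈ D.pm S) ∧
  (∃ n r : ℕ, a 1 = D.twist (-(n : ℤ)) (-(r : ℤ)) α) ∧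
  (∀ i, 1 ≤ i → i ≤ k - 2 → D.chainSum a i ∈ D.pm S) ∧
  (∃ m s : ℕ, D.chainSum a (k - 1) = D.twist (-(m : ℤ)) (-(s : ℤ)) β
      ∨ D.chainSum a (k - 1) = -(D.twist (-(m : ℤ)) (-(s : ℤ)) β))

/-- `α` is connected to `β` (relative to the set of roots `S`). -/
def ConnectedIn (S : Set (Module.Dual K ↥D.H0)) (α β : Module.Dual K ↥D.H0) : Prop :=
  (∃ z₁ z₂ : ℤ, ∃ ε : K, (ε = 1 ∨ ε = -1) ∧ β = ε • D.twist z₁ z₂ α) ∨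
  (∃ k a, D.IsConnectionIn S α β k a)

/-- `α` is connected to `β`. -/
def Connected (α β : Module.Dual K ↥D.H0) : Prop := D.ConnectedIn D.roots α β

/-- The set `[α]` of roots connected to `α`. -/
def classSet (α : Module.Dual K ↥D.H0) : Set (Module.Dual K ↥D.H0) :=
  {β ∈ D.roots | D.Connected α β}

/-- `I_{H,[α]} = span {[A_{β∘ψ⁻¹}, A_{−β∘φ⁻¹}] + A_{β∘ψ⁻¹}·A_{−β∘φ⁻¹} : β ∈ [α]}`. -/
def IH (α : Module.Dual K ↥D.H0) : Submodule K A :=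
  ⨆ β ∈ D.classSet α,
    (Submodule.map₂ D.br (D.rootSpace (D.twist 0 (-1) β)) (D.rootSpace (-(D.twist (-1) 0 β)))
      ⊔ Submodule.map₂ D.mu (D.rootSpace (D.twist 0 (-1) β)) (D.rootSpace (-(D.twist (-1) 0 β))))

/-- `V_{[α]} = ⊕_{β ∈ [α]} A_β`. -/
def VS (α : Module.Dual K ↥D.H0) : Submodule K A :=
  ⨆ β ∈ D.classSet α, D.rootSpace β

/-- `I_{[α]} = I_{H,[α]} ⊕ V_{[α]}`. -/
def Iclass (α : Module.Dual K ↥D.H0) : Submodule K A := D.IH α ⊔ D.VS α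

/-- `J` is an ideal of the (sub)algebra `I`. -/
def IsIdealIn (J I : Submodule K A) : Prop :=
  J ≤ I ∧ J = (J ⊓ D.grade 0) ⊔ (J ⊓ D.grade 1) ∧
  Submodule.map₂ D.br J I ≤ J ∧ Submodule.map₂ D.mu J I ≤ J ∧ Submodule.map₂ D.mu I J ≤ J ∧
  J.map (D.phi : A →ₗ[K] A) = J ∧ J.map (D.psi : A →ₗ[K] A) = J

/-- `I` is an ideal of `A`: `[I,A] + I·A + A·I ⊆ I`, graded and `φ,ψ`-invariant. -/
def IsIdeal (I : Submodule K A) : Prop := D.IsIdealIn I ⊤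

/-- `A` is simple: `[A,A] + A·A ≠ 0` and its only ideals are `0` and `A`. -/
def IsSimple : Prop :=
  (Submodule.map₂ D.br ⊤ ⊤ ⊔ Submodule.map₂ D.mu (⊤ : Submodule K A) ⊤ ≠ ⊥) ∧
  ∀ I : Submodule K A, D.IsIdeal I → I = ⊥ ∨ I = ⊤

/-- The center `Z(A) = {v : [v,A] + v·A + A·v = 0}`. -/
def center : Submodule K A where
  carrier := {v | ∀ w, D.br v w = 0 ∧ D.mu v w = 0 ∧ D.mu w v = 0}
  add_mem' := by
    intro a b ha hb w
    obtain ⟨h1, h2, h3⟩ := ha w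
    obtain ⟨g1, g2, g3⟩ := hb w
    simp [map_add, LinearMap.add_apply, h1, h2, h3, g1, g2, g3]
  zero_mem' := by intro w; simp
  smul_mem' := by
    intro c v hv w
    obtain ⟨h1, h2, h3⟩ := hv w
    simp [map_smul, LinearMap.smul_apply, h1, h2, h3]

/-- `Σ_{α∈Λ} ([A_{α∘ψ⁻¹}, A_{−α∘φ⁻¹}] + A_{α∘ψ⁻¹}·A_{−α∘φ⁻¹})`. -/
def HSum : Submodule K A :=
  ⨆ α ∈ D.roots,
    (Submodule.map₂ D.br (D.rootSpace (D.twist 0 (-1) α)) (D.rootSpace (-(D.twist (-1) 0 α)))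
      ⊔ Submodule.map₂ D.mu (D.rootSpace (D.twist 0 (-1) α)) (D.rootSpace (-(D.twist (-1) 0 α))))

/-- The root system is symmetric. -/
def IsSymmetric : Prop := ∀ α ∈ D.roots, -α ∈ D.roots

/-- `A` is root multiplicative. -/
def RootMultiplicative : Prop :=
  ∀ (i j : ZMod 2) (α β : Module.Dual K ↥D.H0), α ∈ D.roots → β ∈ D.roots →
    D.rootSpace α ⊓ D.grade i ≠ ⊥ → D.rootSpace β ⊓ D.grade j ≠ ⊥ →
    (D.twist 0 (-1) α + D.twist (-1) 0 β) ∈ D.roots →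
    D.rootSpace (D.twist 0 (-1) α + D.twist (-1) 0 β) ⊓ D.grade (i + j) ≠ ⊥ →
    Submodule.map₂ D.br (D.rootSpace α ⊓ D.grade i) (D.rootSpace β ⊓ D.grade j)
      ⊔ Submodule.map₂ D.mu (D.rootSpace α ⊓ D.grade i) (D.rootSpace β ⊓ D.grade j) ≠ ⊥

/-- `A` is of maximal length: every nonzero graded root space is one-dimensional. -/
def MaximalLength : Prop :=
  ∀ (i : ZMod 2), ∀ α ∈ D.roots, D.rootSpace α ⊓ D.grade i ≠ ⊥ →
    Module.rank K ↥(D.rootSpace α ⊓ D.grade i) = 1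

end BHPS

namespace BHPS

variable {K A : Type*}

/-- Every element of `A` is a sum of homogeneous ones. -/
lemma iSup_grade {K A : Type*} [Field K] [AddCommGroup A] [Module K A] (D : BHPS K A) :
    ⨆ i, D.grade i = ⊤ :=
  D.gradeInternal.submodule_iSup_eq_top

/-- Skew-symmetry against an even element carries no sign. -/
lemma br_psi_phi_of_even {K A : Type*} [Field K] [AddCommGroup A] [Module K A] (D : BHPS K A)
    {h : A} (hh : h ∈ D.grade 0) (x : A) :
    D.br (D.psi x) (D.phi h) = -D.br (D.psi h) (D.phi x) := by
  have hx : x ∈ ⨆ i, D.grade i := D.iSup_grade ▸ Submodule.mem_top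
  induction hx using Submodule.iSup_induction' with
  | mem i x hx => simpa using D.skew i 0 x hx h hh
  | zero => simp
  | add x y _ _ hx hy => simp only [map_add, LinearMap.add_apply, hx, hy, neg_add]

/-- The Leibniz identity against an even element carries no sign. -/
lemma leibniz_of_even {K A : Type*} [Field K] [AddCommGroup A] [Module K A] (D : BHPS K A)
    {h : A} (hh : h ∈ D.grade 0) (x y : A) :
    D.br (D.mu x y) (D.phi (D.psi h))
      = D.mu (D.phi x) (D.br y (D.phi h)) + D.mu (D.br x (D.psi h)) (D.phi y) := by
  have hy : y ∈ ⨆ i, D.grade i := D.iSup_grade ▸ Submodule.mem_top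
  induction hy using Submodule.iSup_induction' with
  | mem i y hy => simpa using D.leibniz i 0 x y hy h hh
  | zero => simp
  | add y z _ _ hy hz =>
    simp only [map_add, LinearMap.add_apply, hy, hz]
    abel

lemma coe_phiH0 {K A : Type*} [Field K] [AddCommGroup A] [Module K A] (D : BHPS K A)
    (h : ↥D.H0) : (D.phiH0 h : A) = D.phi h := rfl

lemma coe_psiH0 {K A : Type*} [Field K] [AddCommGroup A] [Module K A] (D : BHPS K A)
    (h : ↥D.H0) : (D.psiH0 h : A) = D.psi h := rfl

lemma twist_neg_one_zero_apply {K A : Type*} [Field K] [AddCommGroup A] [Module K A]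
    (D : BHPS K A) (γ : Module.Dual K ↥D.H0) (h : ↥D.H0) :
    D.twist (-1) 0 γ h = γ (D.phiH0.symm h) := by
  simp only [twist, zpow_neg_one, zpow_zero]
  rfl

lemma twist_zero_neg_one_apply {K A : Type*} [Field K] [AddCommGroup A] [Module K A]
    (D : BHPS K A) (γ : Module.Dual K ↥D.H0) (h : ↥D.H0) :
    D.twist 0 (-1) γ h = γ (D.psiH0.symm h) := by
  simp only [twist, zpow_neg_one, zpow_zero]
  rfl

/-- On a root vector, bracketing by `φ h` from the right is also scalar. -/
lemma br_psi_phi_of_mem_rootSpace {K A : Type*} [Field K] [AddCommGroup A] [Module K A]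
    (D : BHPS K A) {α : Module.Dual K ↥D.H0} {v : A} (hv : v ∈ D.rootSpace α) (h : ↥D.H0) :
    D.br (D.psi v) (D.phi h) = -(α (D.psiH0 h) • D.phi (D.psi v)) := by
  rw [D.br_psi_phi_of_even h.2.2, ← coe_psiH0, hv (D.psiH0 h)]

/-- for `α, β ∈ Λ ∪ {0}`, `A_α · A_β ⊆ A_{α∘φ⁻¹ + β∘ψ⁻¹}`. -/
theorem rootSpace_mul_rootSpace {K A : Type*} [Field K] [AddCommGroup A] [Module K A] (D : BHPS K A)
    (hsplit : D.IsSplit)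
    (α β : Module.Dual K ↥D.H0)
    (hα : α ∈ D.roots ∨ α = 0) (hβ : β ∈ D.roots ∨ β = 0) :
    Submodule.map₂ D.mu (D.rootSpace α) (D.rootSpace β)
      ≤ D.rootSpace (D.twist (-1) 0 α + D.twist 0 (-1) β) := by
  rw [Submodule.map₂_le]
  intro v hv w hw h
  obtain ⟨h', rfl⟩ := D.psiH0.surjective h
  obtain ⟨k, rfl⟩ := D.psiH0.surjective h'
  obtain ⟨l, hl⟩ := D.phiH0.surjective (D.psiH0 k)
  have hα' : D.phiH0.symm (D.psiH0 (D.psiH0 k)) = D.psiH0 l := by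
    rw [LinearEquiv.symm_apply_eq, ← hl]
    ext
    simp only [coe_phiH0, coe_psiH0, D.phi_psi_comm]
  have hvk : D.br (D.psi v) (D.psi k) = -(α (D.psiH0 l) • D.phi (D.psi v)) := by
    rw [← coe_psiH0, ← hl, coe_phiH0, D.br_psi_phi_of_mem_rootSpace hv]
  have hskew := D.br_psi_phi_of_even (D.psiH0 k).2.2 (D.mu v w)
  rw [LinearMap.add_apply, twist_neg_one_zero_apply, twist_zero_neg_one_apply, hα',
    LinearEquiv.symm_apply_apply, coe_psiH0, ← neg_eq_iff_eq_neg.mpr hskew, coe_psiH0, D.psi_mu,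
    D.leibniz_of_even k.2.2, D.br_psi_phi_of_mem_rootSpace hw, hvk, D.phi_mu]
  simp only [map_neg, map_smul, LinearMap.neg_apply, LinearMap.smul_apply, add_smul]
  abel

end BHPS
end

section
/- Let A be a split regular BiHom-Poisson superalgebra with root system Λ. The relation ∼ on Λ, defined by α ∼ β if and only if α is connected to β, is an equivalence relation. -/
namespace BHPS

section Helpers

variable {K A : Type*} [Field K] [AddCommGroup A] [Module K A] (D : BHPS K A)

lemma commute_phiH0_psiH0 : Commute D.phiH0 D.psiH0 := by
  ext h
  exact D.phi_psi_comm h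

@[simp]
lemma twist_apply (a b : ℤ) (γ : Module.Dual K D.H0) (h : D.H0) :
    D.twist a b γ h = γ ((D.phiH0 ^ a) ((D.psiH0 ^ b) h)) := rfl

@[simp]
lemma twist_zero_zero (γ : Module.Dual K D.H0) : D.twist 0 0 γ = γ := by
  ext h
  simp

lemma twist_twist (a b c d : ℤ) (γ : Module.Dual K D.H0) :
    D.twist a b (D.twist c d γ) = D.twist (a + c) (b + d) γ := by
  ext h
  simp only [twist_apply, ← LinearEquiv.mul_apply]
  congr 2
  rw [add_comm a c, add_comm b d, zpow_add, zpow_add, mul_assoc,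
    (D.commute_phiH0_psiH0.zpow_zpow a d).left_comm]

@[simp]
lemma twist_add (a b : ℤ) (γ δ : Module.Dual K D.H0) :
    D.twist a b (γ + δ) = D.twist a b γ + D.twist a b δ := rfl

@[simp]
lemma twist_neg (a b : ℤ) (γ : Module.Dual K D.H0) :
    D.twist a b (-γ) = -D.twist a b γ := rfl

@[simp]
lemma twist_zero (a b : ℤ) : D.twist a b 0 = 0 := rfl

lemma twist_sum {ι : Type*} (a b : ℤ) (s : Finset ι) (f : ι → Module.Dual K D.H0) :
    D.twist a b (∑ i ∈ s, f i) = ∑ i ∈ s, D.twist a b (f i) :=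
  map_sum (AddMonoidHom.mk' (D.twist a b) (D.twist_add a b)) f s

lemma twist_eq_zero_iff (a b : ℤ) (γ : Module.Dual K D.H0) : D.twist a b γ = 0 ↔ γ = 0 := by
  refine ⟨fun h => ?_, fun h => by rw [h, twist_zero]⟩
  have := congrArg (D.twist (-a) (-b)) h
  simpa [twist_twist] using this

/-- An automorphism of the bracket commuting with `φ` and `ψ` and restricting to `H₀` carries
root spaces to root spaces. -/
lemma rootSpace_ne_bot_iff (f : A ≃ₗ[K] A) (f₀ : D.H0 ≃ₗ[K] D.H0)
    (hf₀ : ∀ h, (f₀ h : A) = f h) (hbr : ∀ x y, f (D.br x y) = D.br (f x) (f y))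
    (hphi : ∀ x, f (D.phi x) = D.phi (f x)) (hpsi : ∀ x, f (D.psi x) = D.psi (f x))
    {α β : Module.Dual K D.H0} (hβ : ∀ h, β (f₀ h) = α h) :
    D.rootSpace β ≠ ⊥ ↔ D.rootSpace α ≠ ⊥ := by
  have key : ∀ v, f v ∈ D.rootSpace β ↔ v ∈ D.rootSpace α := by
    intro v
    change (∀ h : D.H0, _ = _) ↔ (∀ h : D.H0, _ = _)
    rw [← f₀.toEquiv.forall_congr_right]
    refine forall_congr' fun h => ?_
    change D.br (f₀ h : A) _ = β (f₀ h) • _ ↔ _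
    rw [hβ, hf₀, ← hphi, ← hbr, ← hpsi, ← hphi, ← map_smul, f.injective.eq_iff]
  simp only [Submodule.ne_bot_iff]
  constructor
  · rintro ⟨w, hw, hw0⟩
    exact ⟨f.symm w, (key _).1 (by simpa using hw), by simpa using hw0⟩
  · rintro ⟨v, hv, hv0⟩
    exact ⟨f v, (key v).2 hv, by simpa using hv0⟩

lemma twist_phi_mem_roots_iff (γ : Module.Dual K D.H0) :
    D.twist 1 0 γ ∈ D.roots ↔ γ ∈ D.roots := by
  refine and_congr (D.twist_eq_zero_iff 1 0 γ).not ?_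
  exact (D.rootSpace_ne_bot_iff D.phi D.phiH0 (fun _ => rfl) D.phi_br (fun _ => rfl)
    D.phi_psi_comm (fun h => by simp)).symm

lemma twist_psi_mem_roots_iff (γ : Module.Dual K D.H0) :
    D.twist 0 1 γ ∈ D.roots ↔ γ ∈ D.roots := by
  refine and_congr (D.twist_eq_zero_iff 0 1 γ).not ?_
  exact (D.rootSpace_ne_bot_iff D.psi D.psiH0 (fun _ => rfl) D.psi_br
    (fun x => (D.phi_psi_comm x).symm) (fun _ => rfl) (fun h => by simp)).symm

lemma twist_mem_roots_iff (a b : ℤ) (γ : Module.Dual K D.H0) :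
    D.twist a b γ ∈ D.roots ↔ γ ∈ D.roots := by
  have hphi : D.twist a b γ ∈ D.roots ↔ D.twist 0 b γ ∈ D.roots := by
    induction a using Int.induction_on with
    | zero => rfl
    | succ i ih =>
      rw [← ih, ← D.twist_phi_mem_roots_iff (D.twist i b γ), twist_twist, add_comm, zero_add]
    | pred i ih => rw [← ih, ← D.twist_phi_mem_roots_iff, twist_twist, zero_add, add_sub_cancel]
  rw [hphi]
  clear hphi
  induction b using Int.induction_on with
  | zero => rw [twist_zero_zero]
  | succ i ih =>
    rw [← D.twist_psi_mem_roots_iff, twist_twist, zero_add, add_comm] at ih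
    exact ih
  | pred i ih =>
    rw [← D.twist_psi_mem_roots_iff, twist_twist, zero_add, add_sub_cancel]
    exact ih

lemma mem_pm_iff {S : Set (Module.Dual K D.H0)} {γ : Module.Dual K D.H0} :
    γ ∈ D.pm S ↔ γ ∈ S ∨ -γ ∈ S := by
  simp [pm]

lemma neg_one_smul_dual (γ : Module.Dual K D.H0) : (-1 : K) • γ = -γ := by
  ext h
  simp

/-- The map `γ ↦ ±γ ∘ φ^{z₁} ∘ ψ^{z₂}`. -/
def signedTwist (ε : ℤˣ) (a b : ℤ) (γ : Module.Dual K D.H0) : Module.Dual K D.H0 :=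
  ε • D.twist a b γ

lemma twist_units_smul (ε : ℤˣ) (a b : ℤ) (γ : Module.Dual K D.H0) :
    D.twist a b (ε • γ) = ε • D.twist a b γ := by
  rcases Int.units_eq_one_or ε with rfl | rfl <;> simp

lemma signedTwist_signedTwist (ε ε' : ℤˣ) (a b c d : ℤ) (γ : Module.Dual K D.H0) :
    D.signedTwist ε a b (D.signedTwist ε' c d γ) = D.signedTwist (ε * ε') (a + c) (b + d) γ := by
  simp only [signedTwist, twist_units_smul, twist_twist, smul_smul]

lemma signedTwist_add (ε : ℤˣ) (a b : ℤ) (γ δ : Module.Dual K D.H0) :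
    D.signedTwist ε a b (γ + δ) = D.signedTwist ε a b γ + D.signedTwist ε a b δ := by
  simp [signedTwist]

lemma signedTwist_twist_comm (ε : ℤˣ) (a b c d : ℤ) (γ : Module.Dual K D.H0) :
    D.signedTwist ε a b (D.twist c d γ) = D.twist c d (D.signedTwist ε a b γ) := by
  simp only [signedTwist, twist_units_smul, twist_twist, add_comm]

@[simp]
lemma signedTwist_one (γ : Module.Dual K D.H0) : D.signedTwist 1 0 0 γ = γ := by
  simp [signedTwist]

lemma signedTwist_mem_pm_iff {ε : ℤˣ} {a b : ℤ} {γ : Module.Dual K D.H0} :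
    D.signedTwist ε a b γ ∈ D.pm D.roots ↔ γ ∈ D.pm D.roots := by
  rcases Int.units_eq_one_or ε with rfl | rfl
  · simp only [mem_pm_iff, signedTwist, one_smul, ← twist_neg, twist_mem_roots_iff]
  · simp only [mem_pm_iff, signedTwist, Units.neg_smul, one_smul, neg_neg, ← twist_neg,
      twist_mem_roots_iff, or_comm]

/-- One link of a connection: `y = x ∘ φ⁻¹ + b ∘ ψ⁻¹` with `x, y, b ∈ ±Λ`. -/
def Link (x y : Module.Dual K D.H0) : Prop :=
  x ∈ D.pm D.roots ∧ y ∈ D.pm D.roots ∧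
    ∃ b ∈ D.pm D.roots, y = D.twist (-1) 0 x + D.twist 0 (-1) b

variable {D}

lemma Link.signedTwist {x y : Module.Dual K D.H0} (h : D.Link x y) (ε : ℤˣ) (a b : ℤ) :
    D.Link (D.signedTwist ε a b x) (D.signedTwist ε a b y) := by
  obtain ⟨hx, hy, c, hc, rfl⟩ := h
  exact ⟨D.signedTwist_mem_pm_iff.2 hx, D.signedTwist_mem_pm_iff.2 hy, D.signedTwist ε a b c,
    D.signedTwist_mem_pm_iff.2 hc, by simp only [signedTwist_add, signedTwist_twist_comm]⟩

lemma Link.reverse {x y : Module.Dual K D.H0} (h : D.Link x y) :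
    D.Link y (D.signedTwist 1 (-2) 0 x) := by
  obtain ⟨hx, hy, c, hc, rfl⟩ := h
  refine ⟨hy, D.signedTwist_mem_pm_iff.2 hx, D.signedTwist (-1) (-1) 0 c,
    D.signedTwist_mem_pm_iff.2 hc, ?_⟩
  simp [BHPS.signedTwist, twist_twist]

lemma reflTransGen_link_signedTwist {x y : Module.Dual K D.H0}
    (h : Relation.ReflTransGen D.Link x y) (ε : ℤˣ) (a b : ℤ) :
    Relation.ReflTransGen D.Link (D.signedTwist ε a b x) (D.signedTwist ε a b y) :=
  h.lift _ fun _ _ h => h.signedTwist ε a b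

lemma reflTransGen_link_reverse {x y : Module.Dual K D.H0}
    (h : Relation.ReflTransGen D.Link x y) :
    ∃ a : ℤ, Relation.ReflTransGen D.Link y (D.signedTwist 1 a 0 x) := by
  induction h using Relation.ReflTransGen.head_induction_on with
  | refl => exact ⟨0, by rw [signedTwist_one]⟩
  | head hxz _ ih =>
    obtain ⟨a, ha⟩ := ih
    refine ⟨a - 2, ha.tail ?_⟩
    simpa [signedTwist_signedTwist, sub_eq_add_neg] using hxz.reverse.signedTwist 1 a 0

lemma chainSum_zero (a : ℕ → Module.Dual K D.H0) : D.chainSum a 0 = a 1 := by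
  simp [chainSum]

lemma chainSum_succ (a : ℕ → Module.Dual K D.H0) (i : ℕ) :
    D.chainSum a (i + 1) = D.twist (-1) 0 (D.chainSum a i) + D.twist 0 (-1) (a (i + 2)) := by
  rw [chainSum, Finset.sum_Icc_succ_top (by omega), chainSum, twist_add, twist_sum, ← add_assoc]
  simp only [twist_twist]
  refine congrArg₂ _ (congrArg₂ _ ?_ (Finset.sum_congr rfl fun t _ => ?_)) ?_
  all_goals
    congr 1
    push_cast
    ring

lemma chainSum_congr {a b : ℕ → Module.Dual K D.H0} {i : ℕ}
    (h : ∀ t, 1 ≤ t → t ≤ i + 1 → a t = b t) : D.chainSum a i = D.chainSum b i := by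
  induction i with
  | zero => simpa [chainSum_zero] using h 1 le_rfl le_rfl
  | succ i ih =>
    rw [chainSum_succ, chainSum_succ, ih fun t h₁ h₂ => h t h₁ (by omega),
      h (i + 2) (by omega) le_rfl]

lemma reflTransGen_link_chainSum {a : ℕ → Module.Dual K D.H0} {i : ℕ}
    (ha : ∀ t, 1 ≤ t → t ≤ i + 1 → a t ∈ D.pm D.roots)
    (hs : ∀ j, 1 ≤ j → j ≤ i → D.chainSum a j ∈ D.pm D.roots) :
    Relation.ReflTransGen D.Link (a 1) (D.chainSum a i) := by
  induction i with
  | zero => rw [chainSum_zero]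
  | succ i ih =>
    refine (ih (fun t h₁ h₂ => ha t h₁ (by omega)) fun j h₁ h₂ => hs j h₁ (by omega)).tail
      ⟨?_, hs (i + 1) (by omega) le_rfl, a (i + 2), ha _ (by omega) le_rfl, chainSum_succ a i⟩
    rcases i.eq_zero_or_pos with rfl | hi
    · simpa only [chainSum_zero] using ha 1 le_rfl (by omega)
    · exact hs i hi (by omega)

lemma exists_chainSum_of_reflTransGen_link {x y : Module.Dual K D.H0} (hx : x ∈ D.pm D.roots)
    (h : Relation.ReflTransGen D.Link x y) :
    ∃ (i : ℕ) (a : ℕ → Module.Dual K D.H0), a 1 = x ∧ D.chainSum a i = y ∧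
      (∀ t, 1 ≤ t → t ≤ i + 1 → a t ∈ D.pm D.roots) ∧
      ∀ j, 1 ≤ j → j ≤ i → D.chainSum a j ∈ D.pm D.roots := by
  induction h with
  | refl =>
    exact ⟨0, fun _ => x, rfl, chainSum_zero _, fun _ _ _ => hx, fun j h₁ h₂ => by omega⟩
  | tail _ hyz ih =>
    obtain ⟨i, a, rfl, rfl, ha, hs⟩ := ih
    obtain ⟨-, hz, b, hb, hzb⟩ := hyz
    have hlow : ∀ t, t ≤ i + 1 → Function.update a (i + 2) b t = a t := fun t ht =>
      Function.update_of_ne (by omega) _ _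
    have hsum : ∀ j, j ≤ i → D.chainSum (Function.update a (i + 2) b) j = D.chainSum a j :=
      fun j hj => chainSum_congr fun t _ ht => hlow t (by omega)
    have htop := chainSum_succ (Function.update a (i + 2) b) i
    rw [hsum i le_rfl, Function.update_self, ← hzb] at htop
    refine ⟨i + 1, Function.update a (i + 2) b, hlow 1 (by omega), htop, fun t h₁ h₂ => ?_,
      fun j h₁ h₂ => ?_⟩
    · rcases Nat.lt_or_ge (i + 1) t with ht | ht
      · obtain rfl : t = i + 2 := by omega
        rwa [Function.update_self]
      · rw [hlow t ht]
        exact ha t h₁ ht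
    · rcases Nat.lt_or_ge i j with hj | hj
      · obtain rfl : j = i + 1 := by omega
        rwa [htop]
      · rw [hsum j hj]
        exact hs j h₁ hj

lemma eq_twist_or_eq_neg_twist_iff {a b : ℤ} {x γ : Module.Dual K D.H0} :
    (x = D.twist a b γ ∨ x = -D.twist a b γ) ↔ ∃ ε : ℤˣ, x = D.signedTwist ε a b γ := by
  constructor
  · rintro (h | h)
    · exact ⟨1, by simpa [signedTwist] using h⟩
    · exact ⟨-1, by simpa [signedTwist] using h⟩
  · rintro ⟨ε, h⟩
    rcases Int.units_eq_one_or ε with rfl | rfl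
    · exact Or.inl (by simpa [signedTwist] using h)
    · exact Or.inr (by simpa [signedTwist] using h)

lemma exists_nat_neg_add_eq_neg (z : ℤ) : ∃ n m : ℕ, -(n : ℤ) + z = -(m : ℤ) :=
  ⟨z.toNat, (-z).toNat, by omega⟩

/-- Two roots are connected if and only if a sequence of links joins the first to a signed twist
of the second. -/
lemma connected_iff_exists_reflTransGen_link {α β : Module.Dual K D.H0} (hα : α ∈ D.roots)
    (hβ : β ∈ D.roots) :
    D.Connected α β ↔
      ∃ (ε : ℤˣ) (a b : ℤ), Relation.ReflTransGen D.Link α (D.signedTwist ε a b β) := by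
  have hα' : α ∈ D.pm D.roots := Or.inl hα
  have hβ' : β ∈ D.pm D.roots := Or.inl hβ
  constructor
  · rintro (⟨z₁, z₂, ε, hε, rfl⟩ | ⟨k, c, hk, hc, ⟨n, r, hc₁⟩, hs, m, s, hend⟩)
    · obtain ⟨ε', h⟩ : ∃ ε' : ℤˣ, ε • D.twist z₁ z₂ α = D.signedTwist ε' z₁ z₂ α := by
        rw [← eq_twist_or_eq_neg_twist_iff]
        rcases hε with rfl | rfl <;> simp [neg_one_smul_dual]
      refine ⟨ε', -z₁, -z₂, ?_⟩
      rw [h, signedTwist_signedTwist]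
      simp only [neg_add_cancel, Int.units_mul_self, signedTwist_one]
      exact .refl
    · obtain ⟨ε, hend⟩ := eq_twist_or_eq_neg_twist_iff.1 hend
      have h := reflTransGen_link_chainSum (i := k - 1) (fun t h₁ h₂ => hc t h₁ (by omega))
        fun j h₁ h₂ => by
          rcases Nat.lt_or_ge (k - 2) j with hj | hj
          · obtain rfl : j = k - 1 := by omega
            rw [hend]
            exact D.signedTwist_mem_pm_iff.2 hβ'
          · exact hs j h₁ hj
      rw [hend, hc₁] at h
      refine ⟨ε, n + -m, r + -s, ?_⟩
      simpa only [signedTwist_signedTwist, one_mul, signedTwist, one_smul, twist_twist,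
        add_neg_cancel, twist_zero_zero, twist_units_smul] using
        reflTransGen_link_signedTwist h 1 n r
  · rintro ⟨ε, a, b, h⟩
    obtain ⟨n, m, hnm⟩ := exists_nat_neg_add_eq_neg a
    obtain ⟨r, s, hrs⟩ := exists_nat_neg_add_eq_neg b
    have h' := reflTransGen_link_signedTwist h 1 (-n) (-r)
    rw [signedTwist_signedTwist, one_mul, hnm, hrs] at h'
    obtain ⟨i, c, hc₁, hend, hc, hs⟩ :=
      exists_chainSum_of_reflTransGen_link (D.signedTwist_mem_pm_iff.2 hα') h'
    rcases i.eq_zero_or_pos with rfl | hi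
    · rw [chainSum_zero, hc₁] at hend
      have e := congrArg (D.signedTwist ε m s) hend
      simp only [signedTwist_signedTwist, add_neg_cancel, Int.units_mul_self, signedTwist_one,
        mul_one] at e
      refine Or.inl ⟨m + -n, s + -r, ?_⟩
      rcases eq_twist_or_eq_neg_twist_iff.2 ⟨ε, e.symm⟩ with h | h
      · exact ⟨1, Or.inl rfl, by simpa using h⟩
      · exact ⟨-1, Or.inr rfl, by rw [neg_one_smul_dual]; exact h⟩
    · refine Or.inr ⟨i + 1, c, by omega, hc, ⟨n, r, by simpa [signedTwist] using hc₁⟩,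
        fun j h₁ h₂ => hs j h₁ (by omega), m, s, ?_⟩
      rw [eq_twist_or_eq_neg_twist_iff]
      exact ⟨ε, hend⟩

end Helpers

end BHPS

namespace BHPS

variable {K A : Type*}

/-- connectedness is an equivalence relation on `Λ`. -/
theorem connected_equivalence {K A : Type*} [Field K] [AddCommGroup A] [Module K A] (D : BHPS K A)
    (hsplit : D.IsSplit) :
    Equivalence (fun α β : ↥D.roots => D.Connected α.1 β.1) := by

  refine ⟨fun α => ?_, fun {α β} h => ?_, fun {α β γ} h₁ h₂ => ?_⟩
  · rw [connected_iff_exists_reflTransGen_link α.2 α.2]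
    exact ⟨1, 0, 0, by rw [signedTwist_one]⟩
  · rw [connected_iff_exists_reflTransGen_link α.2 β.2] at h
    rw [connected_iff_exists_reflTransGen_link β.2 α.2]
    obtain ⟨ε, a, b, h⟩ := h
    obtain ⟨c, hc⟩ := reflTransGen_link_reverse h
    have h' := reflTransGen_link_signedTwist hc ε (-a) (-b)
    simp only [signedTwist_signedTwist, neg_add_cancel, Int.units_mul_self, signedTwist_one] at h'
    exact ⟨_, _, _, h'⟩
  · rw [connected_iff_exists_reflTransGen_link α.2 β.2] at h₁
    rw [connected_iff_exists_reflTransGen_link β.2 γ.2] at h₂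
    rw [connected_iff_exists_reflTransGen_link α.2 γ.2]
    obtain ⟨ε, a, b, h₁⟩ := h₁
    obtain ⟨ε', a', b', h₂⟩ := h₂
    have h := h₁.trans (reflTransGen_link_signedTwist h₂ ε a b)
    rw [signedTwist_signedTwist] at h
    exact ⟨_, _, _, h⟩

end BHPS
end
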